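/- Let V be a finite-dimensional real inner product space with inner product ⟨·,·⟩ and norm ‖·‖, and let F : V × V → ℝ be a continuous function satisfying: (i) F(X,Y) = F(Y,X) for all X,Y; (ii) F(X,Y) ≥ 0 for all X,Y; (iii) F(X, a·Y) = a²·F(X,Y) for all a ∈ ℝ and all X,Y; (iv) F(X, Y+Z) + F(X, Y−Z) = 2·F(X,Y) + 2·F(X,Z) for all X,Y,Z; (v) F(X,X) = 0 for all X; and (vi) whenever F(X,Y) = 0, the vectors X and Y are linearly dependent over ℝ. Then there exists a constant c > 0 such that c·(‖X‖²·‖Y‖² − ⟨X,Y⟩²) ≤ F(X,Y) ≤ c⁻¹·(‖X‖²·‖Y‖² − ⟨X,Y⟩²) for all X, Y ∈ V. -/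

import Mathlib

open scoped RealInnerProductSpace

/-- A nonnegative function satisfying the parallelogram law does not decrease under translation
by one of its zeros. -/
lemma le_apply_add_of_parallelogram {V : Type*} [AddCommGroup V] {q : V → ℝ}
    (hpos : ∀ Y, 0 ≤ q Y) (hpar : ∀ Y Z, q (Y + Z) + q (Y - Z) = 2 * q Y + 2 * q Z)
    {X : V} (hX : q X = 0) (Y : V) : q Y ≤ q (Y + X) := by
  have progression : ∀ n : ℕ, q (Y + n • X) = q Y + n * (q (Y + X) - q Y) ∧
      q (Y + (n + 1) • X) = q Y + (n + 1) * (q (Y + X) - q Y) := by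
    intro n
    induction n with
    | zero => simp
    | succ k ih =>
      refine ⟨by simpa using ih.2, ?_⟩
      have h := hpar (Y + (k + 1) • X) X
      rw [show Y + (k + 1) • X + X = Y + (k + 1 + 1) • X by module,
        show Y + (k + 1) • X - X = Y + k • X by module, ih.1, ih.2, hX] at h
      push_cast
      linarith
  by_contra! hlt
  obtain ⟨n, hn⟩ := exists_nat_gt (q Y / (q Y - q (Y + X)))
  rw [div_lt_iff₀ (sub_pos.2 hlt)] at hn
  have := hpos (Y + n • X)
  rw [(progression n).1] at this
  linarith

/-- A nonnegative function satisfying the parallelogram law is invariant under translation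
by each of its zeros. -/
lemma apply_add_eq_of_parallelogram {V : Type*} [AddCommGroup V] {q : V → ℝ}
    (hpos : ∀ Y, 0 ≤ q Y) (hpar : ∀ Y Z, q (Y + Z) + q (Y - Z) = 2 * q Y + 2 * q Z)
    {X : V} (hX : q X = 0) (Y : V) : q (Y + X) = q Y := by
  have hneg : q (-X) = 0 := by
    have h₀ := hpar 0 X
    have h₁ := hpar 0 0
    simp only [zero_add, zero_sub, sub_zero] at h₀ h₁
    linarith
  have hsub := le_apply_add_of_parallelogram hpos hpar hneg Y
  rw [← sub_eq_add_neg] at hsub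
  linarith [le_apply_add_of_parallelogram hpos hpar hX Y, hpar Y X]

/-- The pairs of orthogonal unit vectors of a finite-dimensional space form a compact set. -/
lemma isCompact_setOf_orthonormal_pair (V : Type*) [NormedAddCommGroup V]
    [InnerProductSpace ℝ V] [FiniteDimensional ℝ V] :
    IsCompact {p : V × V | ‖p.1‖ = 1 ∧ ‖p.2‖ = 1 ∧ ⟪p.1, p.2⟫ = 0} := by
  have : ProperSpace V := FiniteDimensional.proper ℝ V
  refine ((isCompact_sphere (0 : V) 1).prod (isCompact_sphere (0 : V) 1)).of_isClosed_subset ?_ ?_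
  · exact (isClosed_eq (by fun_prop) continuous_const).inter
      ((isClosed_eq (by fun_prop) continuous_const).inter
        (isClosed_eq (by fun_prop) continuous_const))
  · rintro ⟨x, y⟩ ⟨hx, hy, -⟩
    simpa using And.intro hx hy

/-- A biquadratic form that is invariant under `Y ↦ Y + t • X` is determined by its values on
orthonormal pairs, up to the Gram determinant. -/
lemma eq_gram_mul_orthonormal_pair {V : Type*} [NormedAddCommGroup V] [InnerProductSpace ℝ V]
    {F : V → V → ℝ} (hsymm : ∀ X Y : V, F X Y = F Y X)
    (hhom : ∀ (a : ℝ) (X Y : V), F X (a • Y) = a ^ 2 * F X Y)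
    (hadd : ∀ (t : ℝ) (X Y : V), F X (Y + t • X) = F X Y) (X Y : V) :
    (F X Y = 0 ∧ ‖X‖ ^ 2 * ‖Y‖ ^ 2 - ⟪X, Y⟫ ^ 2 = 0) ∨
      ∃ x y : V, (‖x‖ = 1 ∧ ‖y‖ = 1 ∧ ⟪x, y⟫ = 0) ∧
        F X Y = (‖X‖ ^ 2 * ‖Y‖ ^ 2 - ⟪X, Y⟫ ^ 2) * F x y := by
  have hzero : ∀ X : V, F X 0 = 0 := fun X => by simpa using hhom 0 X 0
  rcases eq_or_ne X 0 with rfl | hX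
  · exact .inl ⟨by rw [hsymm, hzero], by simp⟩
  have hX' : ‖X‖ ≠ 0 := norm_ne_zero_iff.2 hX
  obtain ⟨t, ht⟩ : ∃ t : ℝ, t = ⟪X, Y⟫ / ‖X‖ ^ 2 := ⟨_, rfl⟩
  obtain ⟨Z, rfl⟩ : ∃ Z, Y = Z + t • X := ⟨Y - t • X, by simp⟩
  have hXZ : ⟪X, Z⟫ = 0 := by
    rw [inner_add_right, real_inner_smul_right, real_inner_self_eq_norm_sq] at ht
    field_simp at ht
    linarith
  have hgram : ‖X‖ ^ 2 * ‖Z + t • X‖ ^ 2 - ⟪X, Z + t • X⟫ ^ 2 = ‖X‖ ^ 2 * ‖Z‖ ^ 2 := by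
    rw [norm_add_sq_real, inner_add_right, real_inner_smul_right, real_inner_smul_right,
      real_inner_self_eq_norm_sq, real_inner_comm, hXZ, norm_smul, mul_pow, Real.norm_eq_abs,
      sq_abs]
    ring
  rw [hgram, hadd]
  rcases eq_or_ne Z 0 with rfl | hZ
  · exact .inl ⟨hzero X, by simp⟩
  have hZ' : ‖Z‖ ≠ 0 := norm_ne_zero_iff.2 hZ
  refine .inr ⟨‖X‖⁻¹ • X, ‖Z‖⁻¹ • Z, ⟨?_, ?_, ?_⟩, ?_⟩
  · simp [norm_smul, hX']
  · simp [norm_smul, hZ']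
  · simp [real_inner_smul_left, real_inner_smul_right, hXZ]
  · rw [hhom, hsymm (‖X‖⁻¹ • X) Z, hhom, hsymm Z X]
    field_simp

/-- Orthogonal unit vectors are linearly independent. -/
lemma linearIndependent_of_orthonormal_pair {V : Type*} [NormedAddCommGroup V]
    [InnerProductSpace ℝ V] {x y : V} (hx : ‖x‖ = 1) (hy : ‖y‖ = 1) (hxy : ⟪x, y⟫ = 0) :
    LinearIndependent ℝ ![x, y] :=
  Orthonormal.linearIndependent (𝕜 := ℝ) (by simp [orthonormal_vecCons_iff, hx, hy, hxy])

/-- Let `V` be a finite-dimensional real inner product space and `F : V × V → ℝ` a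
continuous function which is symmetric, nonnegative, quadratic in each variable,
satisfies `F X X = 0`, and is non-degenerate (`F X Y = 0` only for linearly dependent
`X, Y`). Then there is a constant `c > 0` with
`c * (‖X‖² ‖Y‖² − ⟪X,Y⟫²) ≤ F X Y ≤ c⁻¹ * (‖X‖² ‖Y‖² − ⟪X,Y⟫²)` for all `X, Y`. -/
theorem stmt9 {V : Type*} [NormedAddCommGroup V] [InnerProductSpace ℝ V]
    [FiniteDimensional ℝ V] (F : V → V → ℝ)
    (hcont : Continuous fun p : V × V => F p.1 p.2)
    (hsymm : ∀ X Y : V, F X Y = F Y X)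
    (hpos : ∀ X Y : V, 0 ≤ F X Y)
    (hhom : ∀ (a : ℝ) (X Y : V), F X (a • Y) = a ^ 2 * F X Y)
    (hpar : ∀ X Y Z : V, F X (Y + Z) + F X (Y - Z) = 2 * F X Y + 2 * F X Z)
    (hnorm : ∀ X : V, F X X = 0)
    (hnondeg : ∀ X Y : V, F X Y = 0 → ¬ LinearIndependent ℝ ![X, Y]) :
    ∃ c : ℝ, 0 < c ∧ ∀ X Y : V,
      c * (‖X‖ ^ 2 * ‖Y‖ ^ 2 - ⟪X, Y⟫ ^ 2) ≤ F X Y ∧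
      F X Y ≤ c⁻¹ * (‖X‖ ^ 2 * ‖Y‖ ^ 2 - ⟪X, Y⟫ ^ 2) := by
  have hadd : ∀ (t : ℝ) (X Y : V), F X (Y + t • X) = F X Y := fun t X Y =>
    apply_add_eq_of_parallelogram (hpos X) (hpar X) (by rw [hhom, hnorm, mul_zero]) Y
  have hK := isCompact_setOf_orthonormal_pair V
  obtain ⟨m, hm, hmF⟩ := hK.exists_forall_le' hcont.continuousOn (a := 0) fun p hp =>
    (hpos p.1 p.2).lt_of_ne' fun h =>
      hnondeg _ _ h (linearIndependent_of_orthonormal_pair hp.1 hp.2.1 hp.2.2)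
  obtain ⟨M, hM⟩ := hK.bddAbove_image hcont.continuousOn
  have hM' : 0 < max M 1 := lt_max_of_lt_right one_pos
  refine ⟨min m (max M 1)⁻¹, lt_min hm (inv_pos.2 hM'), fun X Y => ?_⟩
  have hc : max M 1 ≤ (min m (max M 1)⁻¹)⁻¹ :=
    le_inv_of_le_inv₀ (lt_min hm (inv_pos.2 hM')) (min_le_right _ _)
  have hgram : 0 ≤ ‖X‖ ^ 2 * ‖Y‖ ^ 2 - ⟪X, Y⟫ ^ 2 := by
    rw [← mul_pow, sub_nonneg]
    exact sq_le_sq' (neg_le_of_abs_le (abs_real_inner_le_norm X Y)) (real_inner_le_norm X Y)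
  rcases eq_gram_mul_orthonormal_pair hsymm hhom hadd X Y with ⟨hF, hG⟩ | ⟨x, y, hxy, hF⟩
  · simp [hF, hG]
  · rw [hF, mul_comm _ (F x y)]
    exact ⟨mul_le_mul_of_nonneg_right ((min_le_left _ _).trans (hmF (x, y) hxy)) hgram,
      mul_le_mul_of_nonneg_right
        (((hM ⟨(x, y), hxy, rfl⟩).trans (le_max_left _ _)).trans hc) hgram⟩
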